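/- Let q be an odd prime power, n = q²+q+1, k = (q²+q)/2, and identify the points of the projective plane P²(F_q) with [n]. For q+1 ≤ i ≤ k let 𝓐_i be the family of all i-element subsets of points containing a line, 𝓐 = ⋃_{i=q+1}^{k} 𝓐_i, 𝓠_k = {A ⊆ [n] : |A| ≥ k+1}, and 𝓡_k = 𝓐 ∪ (𝓠_k \ 𝓐̄), where 𝓐̄ = {[n]\A : A ∈ 𝓐}. Then 𝓡_k is regular: every x ∈ [n] is contained in the same number of members of 𝓡_k. -/

import Mathlib

open scoped LinearAlgebra.Projectivization

open Classical in
/-- The family `𝓐_i` of all `i`-element subsets of the points of the projective plane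
`ℙ F (Fin 3 → F)` that contain (all the points of) a line, a line being the set of points
lying in a 2-dimensional linear subspace of `F³`. -/
noncomputable def famA (F : Type) [Field F]
    [Fintype (ℙ F (Fin 3 → F))] (i : ℕ) :
    Finset (Finset (ℙ F (Fin 3 → F))) :=
  Finset.univ.filter (fun A : Finset (ℙ F (Fin 3 → F)) =>
    A.card = i ∧ ∃ W : Submodule F (Fin 3 → F), Module.finrank F W = 2 ∧
      ∀ p : ℙ F (Fin 3 → F), p.submodule ≤ W → p ∈ A)

/-- `𝓐 = ⋃_{i=q+1}^{k} 𝓐_i`. -/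
noncomputable def famAU (F : Type) [Field F] [Fintype F]
    [Fintype (ℙ F (Fin 3 → F))] [DecidableEq (ℙ F (Fin 3 → F))] (k : ℕ) :
    Finset (Finset (ℙ F (Fin 3 → F))) :=
  (Finset.Icc (Fintype.card F + 1) k).biUnion (famA F)

/-- `𝓠_k = {A ⊆ P : |A| ≥ k+1}` for a finite point set `P`. -/
def QfamP (P : Type) [Fintype P] (k : ℕ) : Finset (Finset P) :=
  Finset.univ.filter (fun A => k + 1 ≤ A.card)

/-- The family `𝓕̄` of complements of members of `𝓕`. -/
def complsP {P : Type} [Fintype P] [DecidableEq P] (𝓕 : Finset (Finset P)) :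
    Finset (Finset P) :=
  𝓕.image (fun A => Aᶜ)

/-- `𝓡_k = 𝓐 ∪ (𝓠_k \ 𝓐̄)`. -/
noncomputable def famR (F : Type) [Field F] [Fintype F]
    [Fintype (ℙ F (Fin 3 → F))] [DecidableEq (ℙ F (Fin 3 → F))] (k : ℕ) :
    Finset (Finset (ℙ F (Fin 3 → F))) :=
  famAU F k ∪ (QfamP (ℙ F (Fin 3 → F)) k \ complsP (famAU F k))

/-- The families `𝓐_i` are stable under linear automorphisms. -/
theorem map_mem_famA {F : Type} [Field F] [Fintype (ℙ F (Fin 3 → F))]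
    (g : (Fin 3 → F) ≃ₗ[F] (Fin 3 → F)) {i : ℕ} {A : Finset (ℙ F (Fin 3 → F))}
    (hA : A ∈ famA F i) : A.map (MulAction.toPerm g).toEmbedding ∈ famA F i := by
  simp only [famA, Finset.mem_filter, Finset.mem_univ, true_and, Finset.card_map] at hA ⊢
  obtain ⟨hc, W, hW, hWA⟩ := hA
  refine ⟨hc, W.map g.toLinearMap, by rw [LinearEquiv.finrank_map_eq, hW], fun p hp => ?_⟩
  rw [Finset.mem_map_equiv]
  apply hWA
  induction p using Projectivization.ind with
  | h v hv =>
    rw [Projectivization.submodule_mk, Submodule.span_singleton_le_iff_mem] at hp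
    obtain ⟨w, hw, rfl⟩ := hp
    rw [MulAction.toPerm_symm_apply, Projectivization.smul_mk, Projectivization.submodule_mk,
      Submodule.span_singleton_le_iff_mem]
    have h : g⁻¹ • g.toLinearMap w = w := inv_smul_smul g w
    rwa [h]

theorem map_mem_famAU {F : Type} [Field F] [Fintype F] [Fintype (ℙ F (Fin 3 → F))]
    [DecidableEq (ℙ F (Fin 3 → F))]
    (g : (Fin 3 → F) ≃ₗ[F] (Fin 3 → F)) {k : ℕ} {A : Finset (ℙ F (Fin 3 → F))}
    (hA : A ∈ famAU F k) : A.map (MulAction.toPerm g).toEmbedding ∈ famAU F k := by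
  simp only [famAU, Finset.mem_biUnion] at hA ⊢
  obtain ⟨i, hi, hA⟩ := hA
  exact ⟨i, hi, map_mem_famA g hA⟩

theorem map_inv_map {G α : Type*} [Group G] [MulAction G α] (g : G) (A : Finset α) :
    (A.map (MulAction.toPerm g).toEmbedding).map (MulAction.toPerm g⁻¹).toEmbedding = A := by
  ext x
  simp [Finset.mem_map_equiv, MulAction.toPerm_symm_apply]

theorem mem_complsP {P : Type} [Fintype P] [DecidableEq P] {𝓕 : Finset (Finset P)}
    {A : Finset P} : A ∈ complsP 𝓕 ↔ Aᶜ ∈ 𝓕 := by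
  simp only [complsP, Finset.mem_image]
  exact ⟨by rintro ⟨B, hB, rfl⟩; rwa [compl_compl], fun h => ⟨Aᶜ, h, compl_compl A⟩⟩

/-- The family `𝓡_k` is stable under linear automorphisms. -/
theorem map_mem_famR {F : Type} [Field F] [Fintype F] [Fintype (ℙ F (Fin 3 → F))]
    [DecidableEq (ℙ F (Fin 3 → F))]
    (g : (Fin 3 → F) ≃ₗ[F] (Fin 3 → F)) {k : ℕ} {A : Finset (ℙ F (Fin 3 → F))}
    (hA : A ∈ famR F k) : A.map (MulAction.toPerm g).toEmbedding ∈ famR F k := by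
  simp only [famR, Finset.mem_union, Finset.mem_sdiff, QfamP, Finset.mem_filter,
    Finset.mem_univ, true_and, Finset.card_map, mem_complsP] at hA ⊢
  refine hA.imp (map_mem_famAU g) (And.imp_right fun h hc => h ?_)
  have hcompl : (A.map (MulAction.toPerm g).toEmbedding)ᶜ =
      Aᶜ.map (MulAction.toPerm g).toEmbedding := by
    ext x
    simp [Finset.mem_map_equiv]
  have := map_mem_famAU g⁻¹ hc
  rwa [hcompl, map_inv_map] at this

theorem card_filter_mem_famR_le {F : Type} [Field F] [Fintype F] [Fintype (ℙ F (Fin 3 → F))]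
    [DecidableEq (ℙ F (Fin 3 → F))] (k : ℕ) (x y : ℙ F (Fin 3 → F)) :
    ((famR F k).filter (fun A => x ∈ A)).card ≤ ((famR F k).filter (fun A => y ∈ A)).card := by
  have : MulAction.IsPretransitive ((Fin 3 → F) ≃ₗ[F] (Fin 3 → F)) (ℙ F (Fin 3 → F)) :=
    MulAction.isPretransitive_of_is_two_pretransitive
  obtain ⟨g, rfl⟩ := MulAction.exists_smul_eq ((Fin 3 → F) ≃ₗ[F] (Fin 3 → F)) x y
  refine Finset.card_le_card_of_injOn (fun A => A.map (MulAction.toPerm g).toEmbedding)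
    (fun A hA => ?_) (Finset.map_injective _).injOn
  simp only [Finset.coe_filter, Set.mem_ofPred_eq] at hA ⊢
  refine ⟨map_mem_famR g hA.1, ?_⟩
  rw [Finset.mem_map_equiv]
  simpa [MulAction.toPerm_symm_apply] using hA.2

/-- Let `q` be an odd prime power and `k = (q²+q)/2`.  The family `𝓡_k = 𝓐 ∪ (𝓠_k \ 𝓐̄)`
built from the projective plane over `F_q` is regular: every point lies in the same number
of members of `𝓡_k`. -/
theorem famR_regular (q : ℕ) (hq : Odd q)
    (hpp : ∃ p m : ℕ, p.Prime ∧ 0 < m ∧ q = p ^ m)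
    (F : Type) [Field F] [Fintype F] (hF : Fintype.card F = q)
    [Fintype (ℙ F (Fin 3 → F))] [DecidableEq (ℙ F (Fin 3 → F))]
    (k : ℕ) (hk : k = (q ^ 2 + q) / 2) :
    ∀ x y : ℙ F (Fin 3 → F),
      ((famR F k).filter (fun A => x ∈ A)).card =
        ((famR F k).filter (fun A => y ∈ A)).card := by
  exact fun x y => le_antisymm (card_filter_mem_famR_le k x y) (card_filter_mem_famR_le k y x)
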